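/- Every path-connected, closed, and orthogonally convex set S ⊆ ℝ² is equal to the intersection of a family of staircase-halfplanes (namely, the family of all staircase-halfplanes containing S). -/

import Mathlib

/-- A set `S ⊆ ℝⁿ` is orthogonally convex if its intersection with every
axis-aligned line is connected (possibly empty, i.e. preconnected). -/
def OrthoConvex {n : ℕ} (S : Set (EuclideanSpace ℝ (Fin n))) : Prop :=
  ∀ (i : Fin n) (c : EuclideanSpace ℝ (Fin n)),
    IsPreconnected {p ∈ S | ∀ j, j ≠ i → p j = c j}

/-- The ray issuing from `p` through `q`. -/
def Ray (p q : EuclideanSpace ℝ (Fin 2)) : Set (EuclideanSpace ℝ (Fin 2)) :=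
  {x | ∃ t : ℝ, 0 ≤ t ∧ x = p + t • (q - p)}

/-- `L ⊆ ℝ²` is a staircase line if it is obtained from a simple polyline
`v₀v₁…vₙ` made of nondegenerate axis-aligned segments, in which all step
vectors with odd index have the same direction and all step vectors with even
index have the same direction, by replacing the first segment `v₀v₁` by the
ray from `v₁` through `v₀` and the last segment `v_{n-1}vₙ` by the ray from
`v_{n-1}` through `vₙ`.  Simplicity of the resulting curve is expressed by the
existence of an injective continuous parametrization of `L` by `ℝ`. -/
def IsStaircaseLine (L : Set (EuclideanSpace ℝ (Fin 2))) : Prop :=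
  ∃ (n : ℕ) (v : ℕ → EuclideanSpace ℝ (Fin 2)), 1 ≤ n ∧
    (∀ i : ℕ, 1 ≤ i → i ≤ n →
      v (i - 1) ≠ v i ∧ ((v (i - 1)) 0 = (v i) 0 ∨ (v (i - 1)) 1 = (v i) 1)) ∧
    (∀ i j : ℕ, 1 ≤ i → i ≤ n → 1 ≤ j → j ≤ n → i % 2 = j % 2 →
      ∃ t : ℝ, 0 < t ∧ v j - v (j - 1) = t • (v i - v (i - 1))) ∧
    (∃ φ : ℝ → EuclideanSpace ℝ (Fin 2),
      Continuous φ ∧ Function.Injective φ ∧ Set.range φ = L) ∧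
    L = Ray (v 1) (v 0) ∪ Ray (v (n - 1)) (v n) ∪
      ⋃ i ∈ Set.Ico 1 (n - 1), segment ℝ (v i) (v (i + 1))

/-- A staircase-halfplane is a closed subset of `ℝ²` whose boundary is a
staircase line. -/
def IsStaircaseHalfplane (H : Set (EuclideanSpace ℝ (Fin 2))) : Prop :=
  IsClosed H ∧ IsStaircaseLine (frontier H)

/-- A staircase line `L` strictly separates `A` and `B` if of the two
staircase-halfplanes bounded by `L` (whose union is the plane) one contains
`A` and the other contains `B`, and neither `A` nor `B` meets `L`. -/
def StrictlySeparates (L A B : Set (EuclideanSpace ℝ (Fin 2))) : Prop :=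
  IsStaircaseLine L ∧
    ∃ H₁ H₂ : Set (EuclideanSpace ℝ (Fin 2)),
      IsStaircaseHalfplane H₁ ∧ IsStaircaseHalfplane H₂ ∧
      frontier H₁ = L ∧ frontier H₂ = L ∧ H₁ ∪ H₂ = Set.univ ∧
      A ⊆ H₁ ∧ B ⊆ H₂ ∧ Disjoint A L ∧ Disjoint B L

abbrev E2 := EuclideanSpace ℝ (Fin 2)

theorem helperK {α : Type*} [TopologicalSpace α] (S : Set α) (hS : IsPreconnected S)
    (X Y : α → ℝ) (hX : Continuous X) (hY : Continuous Y) (e : ℝ)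
    (h0 : ∀ q ∈ S, X q = 0 → Y q ≤ -e)
    (hsl : ∀ q₁ ∈ S, ∀ q₂ ∈ S, Y q₁ = Y q₂ → X q₁ < 0 → 0 < X q₂ →
      ∃ q ∈ S, X q = 0 ∧ Y q = Y q₂)
    (b c : α) (hb : b ∈ S) (hc : c ∈ S) (hXb : 0 < X b) (hXc : X c < 0)
    (hYb : -e < Y b) (hbc : Y b ≤ Y c) : False := by
  by_cases hq : ∃ q ∈ S, Y q = Y b ∧ X q < 0
  · obtain ⟨q, hq, hqY, hqX⟩ := hq
    obtain ⟨z, hz, hz0, hzY⟩ := hsl q hq b hb hqY hqX hXb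
    have := h0 z hz hz0
    linarith
  · push Not at hq
    have hU1 : IsOpen {q | X q < 0 ∧ Y b < Y q} :=
      (isOpen_lt hX continuous_const).inter (isOpen_lt continuous_const hY)
    have hU2 : IsOpen {q | 0 < X q ∨ Y q < Y b} :=
      (isOpen_lt continuous_const hX).union (isOpen_lt hY continuous_const)
    have hcY : Y b < Y c := by
      rcases hbc.lt_or_eq with h | h
      · exact h
      · have := hq c hc h.symm
        linarith
    obtain ⟨z, hz, ⟨hz1, hz2⟩, hz3⟩ := hS _ _ hU1 hU2 (by
      intro q hqS
      by_contra hcon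
      simp only [Set.mem_union, Set.mem_ofPred_eq, not_or, not_and_or, not_lt] at hcon
      obtain ⟨h1, h2, h3⟩ := hcon
      have hne : X q ≠ 0 := fun h => by
        have := h0 q hqS h
        linarith
      have hlt : X q < 0 := lt_of_le_of_ne h2 hne
      rcases h1 with h1 | h1
      · linarith
      · have := hq q hqS (le_antisymm h1 h3)
        linarith) ⟨c, hc, hXc, hcY⟩ ⟨b, hb, Or.inl hXb⟩
    rcases hz3 with h | h <;> linarith

theorem lemK {α : Type*} [TopologicalSpace α] (S : Set α) (hS : IsPreconnected S)
    (X Y : α → ℝ) (hX : Continuous X) (hY : Continuous Y) (e : ℝ)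
    (h0 : ∀ q ∈ S, X q = 0 → Y q ≤ -e)
    (hsl : ∀ q₁ ∈ S, ∀ q₂ ∈ S, Y q₁ = Y q₂ → X q₁ < 0 → 0 < X q₂ →
      ∃ q ∈ S, X q = 0 ∧ Y q = Y q₂) :
    (∀ q ∈ S, Y q ≤ -e ∨ X q < 0) ∨ (∀ q ∈ S, Y q ≤ -e ∨ 0 < X q) := by
  by_contra hcon
  push Not at hcon
  obtain ⟨⟨b, hb, hbY, hbX⟩, ⟨c, hc, hcY, hcX⟩⟩ := hcon
  have hbX' : 0 < X b := lt_of_le_of_ne hbX (fun h => by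
    have := h0 b hb h.symm
    linarith)
  have hcX' : X c < 0 := lt_of_le_of_ne hcX (fun h => by
    have := h0 c hc h
    linarith)
  rcases le_total (Y b) (Y c) with h | h
  · exact helperK S hS X Y hX hY e h0 hsl b c hb hc hbX' hcX' hbY h
  · refine helperK S hS (fun q => - X q) Y hX.neg hY e (fun q hq h => h0 q hq (by linarith)) ?_
      c b hc hb (by linarith) (by linarith) hcY h
    intro q₁ h₁ q₂ h₂ hYY hx1 hx2
    obtain ⟨q, hq, hq0, hqY⟩ := hsl q₂ h₂ q₁ h₁ hYY.symm (by linarith) (by linarith)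
    exact ⟨q, hq, by linarith, by linarith⟩

noncomputable def stP (s r a b : ℝ) : E2 := !₂[s * a, r * b]

theorem stP_zero (s r a b : ℝ) : stP s r a b 0 = s * a := by simp [stP]
theorem stP_one (s r a b : ℝ) : stP s r a b 1 = r * b := by simp [stP]

theorem stP_eta (s r : ℝ) (hs : s * s = 1) (hr : r * r = 1) (x : E2) :
    stP s r (s * x 0) (r * x 1) = x := by
  ext i; fin_cases i
  · simp [stP, ← mul_assoc, hs]
  · simp [stP, ← mul_assoc, hr]

theorem stP_inj (s r : ℝ) (hs : s * s = 1) (hr : r * r = 1) (a b a' b' : ℝ) :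
    stP s r a b = stP s r a' b' ↔ a = a' ∧ b = b' := by
  constructor
  · intro h
    have h0 : stP s r a b 0 = stP s r a' b' 0 := by rw [h]
    have h1 : stP s r a b 1 = stP s r a' b' 1 := by rw [h]
    rw [stP_zero, stP_zero] at h0
    rw [stP_one, stP_one] at h1
    have hs0 : s ≠ 0 := by rintro rfl; simp at hs
    have hr0 : r ≠ 0 := by rintro rfl; simp at hr
    exact ⟨mul_left_cancel₀ hs0 h0, mul_left_cancel₀ hr0 h1⟩
  · rintro ⟨rfl, rfl⟩; rfl

theorem stP_lin (s r a b a1 b1 a2 b2 t : ℝ) :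
    stP s r a b + t • (stP s r a1 b1 - stP s r a2 b2) =
      stP s r (a + t * (a1 - a2)) (b + t * (b1 - b2)) := by
  ext i; fin_cases i <;> simp [stP] <;> ring

theorem stP_sub (s r a b a1 b1 : ℝ) :
    stP s r a b - stP s r a1 b1 = stP s r (a - a1) (b - b1) := by
  ext i; fin_cases i <;> simp [stP] <;> ring

theorem stP_smul (s r a b t : ℝ) :
    t • stP s r a b = stP s r (t * a) (t * b) := by
  ext i; fin_cases i <;> simp [stP] <;> ring

theorem mem_ray_stP (s r : ℝ) (hs : s * s = 1) (hr : r * r = 1) (a b a1 b1 a2 b2 : ℝ) :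
    stP s r a b ∈ Ray (stP s r a1 b1) (stP s r a2 b2) ↔
      ∃ t : ℝ, 0 ≤ t ∧ a = a1 + t * (a2 - a1) ∧ b = b1 + t * (b2 - b1) := by
  simp only [Ray, Set.mem_ofPred_eq]
  refine exists_congr fun t => and_congr_right fun _ => ?_
  rw [stP_lin, stP_inj s r hs hr]

theorem mem_seg_stP (s r : ℝ) (hs : s * s = 1) (hr : r * r = 1) (a b a1 b1 a2 b2 : ℝ) :
    stP s r a b ∈ segment ℝ (stP s r a1 b1) (stP s r a2 b2) ↔
      ∃ t : ℝ, (0 ≤ t ∧ t ≤ 1) ∧ a = a1 + t * (a2 - a1) ∧ b = b1 + t * (b2 - b1) := by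
  rw [segment_eq_image']
  simp only [Set.mem_image, Set.mem_Icc]
  refine exists_congr fun t => and_congr_right fun _ => ?_
  rw [stP_lin, stP_inj s r hs hr]
  constructor <;> rintro ⟨h1, h2⟩ <;> exact ⟨h1.symm, h2.symm⟩

noncomputable def stG (u1 w1 u2 w2 a b : ℝ) : ℝ :=
  min (min (a - u1) (b - w1)) (max (a - u2) (b - w2))

noncomputable def stF (s r u1 w1 u2 w2 : ℝ) (x : E2) : ℝ := stG u1 w1 u2 w2 (s * x 0) (r * x 1)

theorem stG_add (u1 w1 u2 w2 a b d : ℝ) :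
    stG u1 w1 u2 w2 (a + d) (b + d) = stG u1 w1 u2 w2 a b + d := by
  simp only [stG, ← min_add_add_right, ← max_add_add_right]
  congr 2 <;> ring_nf

theorem stF_stP (s r : ℝ) (hs : s * s = 1) (hr : r * r = 1) (u1 w1 u2 w2 a b : ℝ) :
    stF s r u1 w1 u2 w2 (stP s r a b) = stG u1 w1 u2 w2 a b := by
  simp only [stF, stP_zero, stP_one, ← mul_assoc, hs, hr, one_mul]

theorem stF_cont (s r u1 w1 u2 w2 : ℝ) : Continuous (stF s r u1 w1 u2 w2) := by
  unfold stF stG; fun_prop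

theorem stP_cont {α : Type*} [TopologicalSpace α] (s r : ℝ) (f g : α → ℝ) (hf : Continuous f)
    (hg : Continuous g) : Continuous (fun x => stP s r (f x) (g x)) := by
  unfold stP
  refine (PiLp.continuous_toLp 2 _).comp (continuous_pi fun i => ?_)
  fin_cases i
  · exact continuous_const.mul hf
  · exact continuous_const.mul hg

theorem stG_zero_iff (u1 w1 u2 w2 a b : ℝ) (hu : u1 < u2) (hw : w1 < w2) :
    stG u1 w1 u2 w2 a b = 0 ↔
      (a = u1 ∧ w2 ≤ b) ∨ (b = w1 ∧ u2 ≤ a) ∨ (b = w2 ∧ u1 ≤ a ∧ a ≤ u2) ∨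
        (a = u2 ∧ w1 ≤ b ∧ b ≤ w2) := by
  unfold stG
  constructor
  · intro h
    rcases min_choice (min (a - u1) (b - w1)) (max (a - u2) (b - w2)) with h1 | h1 <;>
    rcases min_choice (a - u1) (b - w1) with h2 | h2 <;>
    rcases max_choice (a - u2) (b - w2) with h3 | h3 <;>
    have g1 := min_le_left (min (a - u1) (b - w1)) (max (a - u2) (b - w2)) <;>
    have g2 := min_le_right (min (a - u1) (b - w1)) (max (a - u2) (b - w2)) <;>
    have g3 := min_le_left (a - u1) (b - w1) <;>
    have g4 := min_le_right (a - u1) (b - w1) <;>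
    have g5 := le_max_left (a - u2) (b - w2) <;>
    have g6 := le_max_right (a - u2) (b - w2)
    · right; left; constructor <;> linarith
    · left; constructor <;> linarith
    · right; left; constructor <;> linarith
    · left; constructor <;> linarith
    · right; right; right; refine ⟨?_, ?_, ?_⟩ <;> linarith
    · right; right; left; refine ⟨?_, ?_, ?_⟩ <;> linarith
    · right; right; right; refine ⟨?_, ?_, ?_⟩ <;> linarith
    · right; right; left; refine ⟨?_, ?_, ?_⟩ <;> linarith
  · rintro (⟨h1, h2⟩ | ⟨h1, h2⟩ | ⟨h1, h2, h3⟩ | ⟨h1, h2, h3⟩)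
    · rw [max_eq_right (by linarith), min_eq_left (a := a - u1) (by linarith),
        min_eq_left (by linarith)]; linarith
    · rw [max_eq_left (by linarith), min_eq_right (a := a - u1) (by linarith),
        min_eq_left (by linarith)]; linarith
    · rw [max_eq_right (by linarith), min_eq_right]
      · linarith
      · apply le_min <;> linarith
    · rw [max_eq_left (by linarith), min_eq_right]
      · linarith
      · apply le_min <;> linarith

theorem stG_le_iff (u1 w1 u2 w2 a b : ℝ) : stG u1 w1 u2 w2 a b ≤ 0 ↔
    (a ≤ u1 ∨ b ≤ w1) ∨ (a ≤ u2 ∧ b ≤ w2) := by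
  simp only [stG, min_le_iff, max_le_iff, sub_nonpos]

theorem stG_ge_iff (u1 w1 u2 w2 a b : ℝ) : 0 ≤ stG u1 w1 u2 w2 a b ↔
    (u1 ≤ a ∧ w1 ≤ b) ∧ (u2 ≤ a ∨ w2 ≤ b) := by
  simp only [stG, le_min_iff, le_max_iff, sub_nonneg]

noncomputable def stV (s r u1 w1 u2 w2 : ℝ) : ℕ → E2
  | 0 => stP s r u1 (w2 + 1)
  | 1 => stP s r u1 w2
  | 2 => stP s r u2 w2
  | 3 => stP s r u2 w1
  | _ => stP s r (u2 + 1) w1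

theorem stLine (s r : ℝ) (hs : s * s = 1) (hr : r * r = 1) (u1 w1 u2 w2 : ℝ)
    (hu : u1 < u2) (hw : w1 < w2) :
    IsStaircaseLine {x | stF s r u1 w1 u2 w2 x = 0} := by
  have hu' : 0 < u2 - u1 := by linarith
  have hw' : 0 < w2 - w1 := by linarith
  refine ⟨4, stV s r u1 w1 u2 w2, by norm_num, ?_, ?_, ?_, ?_⟩
  · intro i h1 h2
    interval_cases i <;> simp only [stV, ne_eq, stP_inj s r hs hr, stP_zero, stP_one] <;> norm_num
    · exact hu.ne
    · exact hw.ne'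
  · intro i j hi1 hi4 hj1 hj4 hij
    interval_cases i <;> interval_cases j <;> first | (exfalso; omega) | skip
    all_goals simp only [stV, stP_sub, stP_smul, stP_inj s r hs hr]
    · exact ⟨1, by norm_num, by ring, by ring⟩
    · exact ⟨w2 - w1, hw', by ring, by ring⟩
    · exact ⟨1, by norm_num, by ring, by ring⟩
    · exact ⟨1 / (u2 - u1), by positivity, by field_simp; ring, by ring⟩
    · exact ⟨1 / (w2 - w1), by positivity, by ring, by field_simp; ring⟩
    · exact ⟨1, by norm_num, by ring, by ring⟩
    · exact ⟨u2 - u1, hu', by ring, by ring⟩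
    · exact ⟨1, by norm_num, by ring, by ring⟩
  · refine ⟨fun t => stP s r (t + -stG u1 w1 u2 w2 t (-t)) (-t + -stG u1 w1 u2 w2 t (-t)),
      ?_, ?_, ?_⟩
    · apply stP_cont <;> (unfold stG; fun_prop)
    · intro t t' h
      obtain ⟨h1, h2⟩ := (stP_inj s r hs hr _ _ _ _).1 h
      linarith
    · ext x
      constructor
      · rintro ⟨t, rfl⟩
        simp only [Set.mem_ofPred_eq]
        rw [stF_stP s r hs hr, stG_add]; ring
      · intro hx
        simp only [Set.mem_ofPred_eq, stF] at hx
        refine ⟨(s * x 0 - r * x 1) / 2, ?_⟩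
        have : stG u1 w1 u2 w2 ((s * x 0 - r * x 1) / 2) (-((s * x 0 - r * x 1) / 2)) =
            -((s * x 0 + r * x 1) / 2) := by
          have := stG_add u1 w1 u2 w2 (s * x 0) (r * x 1) (-((s * x 0 + r * x 1) / 2))
          rw [hx, zero_add] at this
          rw [← this]; congr 1 <;> ring
        simp only [this]
        conv_rhs => rw [← stP_eta s r hs hr x]
        congr 1 <;> ring
  · ext x
    rw [← stP_eta s r hs hr x]
    generalize s * x 0 = a
    generalize r * x 1 = b
    have hI : (⋃ i ∈ Set.Ico 1 (4 - 1), segment ℝ (stV s r u1 w1 u2 w2 i)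
        (stV s r u1 w1 u2 w2 (i + 1))) =
        segment ℝ (stP s r u1 w2) (stP s r u2 w2) ∪ segment ℝ (stP s r u2 w2) (stP s r u2 w1) := by
      have : Set.Ico 1 (4 - 1) = ({1, 2} : Set ℕ) := by
        ext i; simp only [Set.mem_Ico, Set.mem_insert_iff, Set.mem_singleton_iff]; omega
      rw [this, Set.biUnion_insert, Set.biUnion_singleton]; rfl
    rw [hI]
    simp only [Set.mem_union, Set.mem_ofPred_eq, stF_stP s r hs hr, stV,
      mem_ray_stP s r hs hr, mem_seg_stP s r hs hr, stG_zero_iff _ _ _ _ _ _ hu hw]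
    constructor
    · rintro (⟨h1, h2⟩ | ⟨h1, h2⟩ | ⟨h1, h2, h3⟩ | ⟨h1, h2, h3⟩)
      · exact Or.inl (Or.inl ⟨b - w2, by linarith, by rw [h1]; ring, by ring⟩)
      · exact Or.inl (Or.inr ⟨a - u2, by linarith, by ring, by rw [h1]; ring⟩)
      · refine Or.inr (Or.inl ⟨(a - u1) / (u2 - u1), ⟨by apply div_nonneg <;> linarith, ?_⟩, ?_, ?_⟩)
        · rw [div_le_one hu']; linarith
        · field_simp; ring
        · rw [h1]; ring
      · refine Or.inr (Or.inr ⟨(w2 - b) / (w2 - w1), ⟨by apply div_nonneg <;> linarith, ?_⟩, ?_, ?_⟩)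
        · rw [div_le_one hw']; linarith
        · rw [h1]; ring
        · field_simp; ring
    · rintro ((⟨t, h0, h1, h2⟩ | ⟨t, h0, h1, h2⟩) | (⟨t, ⟨h0, h3⟩, h1, h2⟩ | ⟨t, ⟨h0, h3⟩, h1, h2⟩))
      · left; constructor <;> linarith
      · right; left; constructor <;> linarith
      · right; right; left
        refine ⟨by linarith, by nlinarith, by nlinarith⟩
      · right; right; right
        refine ⟨by linarith, by nlinarith, by nlinarith⟩

theorem stF_shift (s r : ℝ) (hs : s * s = 1) (hr : r * r = 1) (u1 w1 u2 w2 : ℝ) (x : E2) (d : ℝ) :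
    stF s r u1 w1 u2 w2 (stP s r (s * x 0 + d) (r * x 1 + d)) = stF s r u1 w1 u2 w2 x + d := by
  rw [stF_stP s r hs hr, stG_add]; rfl

theorem stHalf (s r : ℝ) (hs : s * s = 1) (hr : r * r = 1) (u1 w1 u2 w2 : ℝ)
    (hu : u1 < u2) (hw : w1 < w2) :
    IsStaircaseHalfplane {x | stF s r u1 w1 u2 w2 x ≤ 0} ∧
    IsStaircaseHalfplane {x | 0 ≤ stF s r u1 w1 u2 w2 x} := by
  have hc := stF_cont s r u1 w1 u2 w2
  have hL := stLine s r hs hr u1 w1 u2 w2 hu hw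
  have hmap : ∀ x : E2, Continuous fun d : ℝ => stP s r (s * x 0 + d) (r * x 1 + d) :=
    fun x => stP_cont s r _ _ (by fun_prop) (by fun_prop)
  have hx0 : ∀ x : E2, stP s r (s * x 0 + 0) (r * x 1 + 0) = x := fun x => by
    rw [add_zero, add_zero, stP_eta s r hs hr]
  have key1 : frontier {x | stF s r u1 w1 u2 w2 x ≤ 0} = {x | stF s r u1 w1 u2 w2 x = 0} := by
    apply Set.Subset.antisymm (frontier_le_subset_eq hc continuous_const)
    intro x hx
    refine ⟨subset_closure (le_of_eq hx), fun hi => ?_⟩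
    have := (hmap x).continuousAt (x := 0) (show interior {x | stF s r u1 w1 u2 w2 x ≤ 0} ∈ _ by
      rw [hx0]; exact isOpen_interior.mem_nhds hi)
    obtain ⟨e, he, hball⟩ := Metric.mem_nhds_iff.1 (Filter.mem_map.1 this)
    have h2 := interior_subset (hball (show e / 2 ∈ Metric.ball (0:ℝ) e by
      rw [Metric.mem_ball, Real.dist_eq, sub_zero, abs_of_pos] <;> linarith))
    simp only [Set.mem_ofPred_eq, stF_shift s r hs hr] at h2 hx
    linarith
  have key2 : frontier {x | 0 ≤ stF s r u1 w1 u2 w2 x} = {x | stF s r u1 w1 u2 w2 x = 0} := by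
    apply Set.Subset.antisymm
    · intro x hx
      exact (frontier_le_subset_eq continuous_const hc hx).symm
    intro x hx
    refine ⟨subset_closure (le_of_eq (Eq.symm hx)), fun hi => ?_⟩
    have := (hmap x).continuousAt (x := 0) (show interior {x | 0 ≤ stF s r u1 w1 u2 w2 x} ∈ _ by
      rw [hx0]; exact isOpen_interior.mem_nhds hi)
    obtain ⟨e, he, hball⟩ := Metric.mem_nhds_iff.1 (Filter.mem_map.1 this)
    have h2 := interior_subset (hball (show -(e / 2) ∈ Metric.ball (0:ℝ) e by
      rw [Metric.mem_ball, Real.dist_eq, sub_zero, abs_neg, abs_of_pos] <;> linarith))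
    simp only [Set.mem_ofPred_eq, stF_shift s r hs hr] at h2 hx
    linarith
  refine ⟨⟨isClosed_le hc continuous_const, by rw [key1]; exact hL⟩,
    ⟨isClosed_le continuous_const hc, by rw [key2]; exact hL⟩⟩

theorem oc_slice (S : Set E2) (hoc : OrthoConvex S) (i j : Fin 2) (hij : i ≠ j) (q₁ q₂ : E2)
    (h₁ : q₁ ∈ S) (h₂ : q₂ ∈ S) (h : q₁ j = q₂ j) (c : ℝ) (hc1 : q₁ i ≤ c) (hc2 : c ≤ q₂ i) :
    ∃ q ∈ S, q i = c ∧ q j = q₁ j := by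
  have H := (hoc i q₁).image (fun q : E2 => q i) (by fun_prop)
  have hj : ∀ k : Fin 2, k ≠ i → k = j := by omega
  obtain ⟨q, ⟨hq, hqj⟩, hqi⟩ := H.ordConnected.out (x := q₁ i) (y := q₂ i)
    ⟨q₁, ⟨h₁, fun k _ => rfl⟩, rfl⟩
    ⟨q₂, ⟨h₂, fun k hk => by rw [hj k hk, h]⟩, rfl⟩ ⟨hc1, hc2⟩
  exact ⟨q, hq, hqi, hqj j hij.symm⟩

theorem ext2 (p q : E2) (i j : Fin 2) (hij : i ≠ j) (hi : p i = q i) (hj : p j = q j) : p = q := by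
  ext k
  have : k = i ∨ k = j := by omega
  rcases this with rfl | rfl <;> assumption

theorem oc_sign (S : Set E2) (hoc : OrthoConvex S) (i j : Fin 2) (hij : i ≠ j) (p : E2)
    (hp : p ∉ S) : ∃ s : ℝ, s * s = 1 ∧ ∀ q ∈ S, q j = p j → s * (q i - p i) < 0 := by
  by_contra hcon
  push Not at hcon
  obtain ⟨q1, h1, h1j, h1i⟩ := hcon 1 (by norm_num)
  obtain ⟨q2, h2, h2j, h2i⟩ := hcon (-1) (by norm_num)
  obtain ⟨q, hq, hqi, hqj⟩ := oc_slice S hoc i j hij q2 q1 h2 h1 (by rw [h1j, h2j]) (p i)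
    (by linarith) (by linarith)
  exact hp (ext2 q p i j hij hqi (by rw [hqj, h2j]) ▸ hq)

theorem oc_slice_sgn (S : Set E2) (hoc : OrthoConvex S) (i j : Fin 2) (hij : i ≠ j) (s : ℝ)
    (hs : s * s = 1) (p : E2) (q₁ q₂ : E2)
    (h₁ : q₁ ∈ S) (h₂ : q₂ ∈ S) (h : q₁ j = q₂ j) (hc1 : s * (q₁ i - p i) < 0)
    (hc2 : 0 < s * (q₂ i - p i)) :
    ∃ q ∈ S, q i = p i ∧ q j = q₁ j := by
  rcases mul_self_eq_one_iff.1 hs with rfl | rfl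
  · exact oc_slice S hoc i j hij q₁ q₂ h₁ h₂ h _ (by linarith) (by linarith)
  · obtain ⟨q, h1, h2, h3⟩ :=
      oc_slice S hoc i j hij q₂ q₁ h₂ h₁ h.symm (p i) (by linarith) (by linarith)
    exact ⟨q, h1, h2, h3.trans h.symm⟩

theorem box_exists (S : Set E2) (hcl : IsClosed S) (p : E2) (hp : p ∉ S) :
    ∃ e : ℝ, 0 < e ∧ ∀ q ∈ S, e ≤ |q 0 - p 0| ∨ e ≤ |q 1 - p 1| := by
  obtain ⟨e, he, hb⟩ := Metric.mem_nhds_iff.1 (hcl.isOpen_compl.mem_nhds hp)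
  refine ⟨e / 2, by linarith, fun q hq => ?_⟩
  by_contra hcon
  push Not at hcon
  refine hb (show q ∈ Metric.ball p e from ?_) hq
  rw [Metric.mem_ball, EuclideanSpace.dist_eq, Fin.sum_univ_two, Real.dist_eq, Real.dist_eq,
    Real.sqrt_lt' he]
  have h1 := pow_lt_pow_left₀ hcon.1 (abs_nonneg _) two_ne_zero
  have h2 := pow_lt_pow_left₀ hcon.2 (abs_nonneg _) two_ne_zero
  nlinarith

theorem c1 {e X Y : ℝ} (he : 0 < e) (h3 : e ≤ |X| ∨ e ≤ |Y|)
    (h1 : Y ≤ -e ∨ X < 0) (h2 : X ≤ -e ∨ Y < 0) :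
    X ≤ -e ∨ Y ≤ -e := by
  rw [le_abs, le_abs] at h3
  by_contra hcon
  simp only [not_or, not_and_or, not_le, not_lt] at hcon
  rcases h1 with h1 | h1 <;> rcases h2 with h2 | h2 <;> rcases h3 with (h3 | h3) | (h3 | h3) <;>
    first | linarith | (rcases hcon with ⟨hc1 | hc1, hc2 | hc2⟩ <;> linarith) | (rcases hcon with ⟨hc1, hc2⟩; linarith) | (rcases hcon with ⟨⟨hc1, hc3⟩, hc2 | hc2⟩ <;> linarith)

theorem c2 {e X Y : ℝ} (he : 0 < e) (h3 : e ≤ |X| ∨ e ≤ |Y|)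
    (h1 : Y ≤ -e ∨ X < 0) (h2 : X ≤ -e ∨ 0 < Y) :
    (X ≤ -e ∨ 2 * e ≤ Y) ∨ (X ≤ 0 ∧ e ≤ Y) := by
  rw [le_abs, le_abs] at h3
  by_contra hcon
  simp only [not_or, not_and_or, not_le, not_lt] at hcon
  rcases h1 with h1 | h1 <;> rcases h2 with h2 | h2 <;> rcases h3 with (h3 | h3) | (h3 | h3) <;>
    first | linarith | (rcases hcon with ⟨hc1 | hc1, hc2 | hc2⟩ <;> linarith) | (rcases hcon with ⟨hc1, hc2⟩; linarith) | (rcases hcon with ⟨⟨hc1, hc3⟩, hc2 | hc2⟩ <;> linarith)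

theorem c3 {e X Y : ℝ} (he : 0 < e) (h3 : e ≤ |X| ∨ e ≤ |Y|)
    (h1 : Y ≤ -e ∨ 0 < X) (h2 : X ≤ -e ∨ Y < 0) :
    (2 * e ≤ X ∨ Y ≤ -e) ∨ (e ≤ X ∧ Y ≤ 0) := by
  rw [le_abs, le_abs] at h3
  by_contra hcon
  simp only [not_or, not_and_or, not_le, not_lt] at hcon
  rcases h1 with h1 | h1 <;> rcases h2 with h2 | h2 <;> rcases h3 with (h3 | h3) | (h3 | h3) <;>
    first | linarith | (rcases hcon with ⟨hc1 | hc1, hc2 | hc2⟩ <;> linarith) | (rcases hcon with ⟨hc1, hc2⟩; linarith) | (rcases hcon with ⟨⟨hc1, hc3⟩, hc2 | hc2⟩ <;> linarith)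

theorem c4 {e X Y : ℝ} (he : 0 < e) (h3 : e ≤ |X| ∨ e ≤ |Y|)
    (h1 : Y ≤ -e ∨ 0 < X) (h2 : X ≤ -e ∨ 0 < Y) :
    (X < 0 ∧ Y ≤ -e) ∨ (0 < X ∧ 0 < Y) := by
  rw [le_abs, le_abs] at h3
  by_contra hcon
  simp only [not_or, not_and_or, not_le, not_lt] at hcon
  rcases h1 with h1 | h1 <;> rcases h2 with h2 | h2 <;> rcases h3 with (h3 | h3) | (h3 | h3) <;>
    first | linarith | (rcases hcon with ⟨hc1 | hc1, hc2 | hc2⟩ <;> linarith) | (rcases hcon with ⟨hc1, hc2⟩; linarith) | (rcases hcon with ⟨⟨hc1, hc3⟩, hc2 | hc2⟩ <;> linarith)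

theorem oc_sep (S : Set E2) (hpc : IsPreconnected S) (hcl : IsClosed S) (hoc : OrthoConvex S)
    (p : E2) (hp : p ∉ S) : ∃ H, IsStaircaseHalfplane H ∧ S ⊆ H ∧ p ∉ H := by
  obtain ⟨e, he, hbox⟩ := box_exists S hcl p hp
  obtain ⟨s, hs, hsX⟩ := oc_sign S hoc 0 1 (by decide) p hp
  obtain ⟨r, hr, hrY⟩ := oc_sign S hoc 1 0 (by decide) p hp
  have habs : ∀ s : ℝ, s * s = 1 → ∀ x : ℝ, |x| = |s * x| := by
    intro s hs x
    rw [abs_mul]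
    rcases mul_self_eq_one_iff.1 hs with rfl | rfl <;> simp
  have hs0 : s ≠ 0 := by rintro rfl; simp at hs
  have hr0 : r ≠ 0 := by rintro rfl; simp at hr
  obtain ⟨X, hX⟩ : ∃ X : E2 → ℝ, X = fun q => s * (q 0 - p 0) := ⟨_, rfl⟩
  obtain ⟨Y, hY⟩ : ∃ Y : E2 → ℝ, Y = fun q => r * (q 1 - p 1) := ⟨_, rfl⟩
  have hXc : Continuous X := by rw [hX]; fun_prop
  have hYc : Continuous Y := by rw [hY]; fun_prop
  have hX0 : ∀ q, X q = 0 ↔ q 0 = p 0 := fun q => by simp [hX, hs0, sub_eq_zero]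
  have hY0 : ∀ q, Y q = 0 ↔ q 1 = p 1 := fun q => by simp [hY, hr0, sub_eq_zero]
  have hXX : ∀ q q', X q = X q' ↔ q 0 = q' 0 := fun q q' => by simp [hX, hs0]
  have hYY : ∀ q q', Y q = Y q' ↔ q 1 = q' 1 := fun q q' => by simp [hY, hr0]
  have hbox' : ∀ q ∈ S, e ≤ |X q| ∨ e ≤ |Y q| := by
    intro q hq
    have := hbox q hq
    rw [habs s hs (q 0 - p 0), habs r hr (q 1 - p 1)] at this
    simpa only [hX, hY] using this
  have hA : ∀ q ∈ S, X q = 0 → Y q ≤ -e := by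
    intro q hq h
    have h1 := hrY q hq ((hX0 q).1 h)
    have h2 : Y q < 0 := by simpa [hY] using h1
    have h3 := hbox' q hq
    rw [h, abs_zero, abs_of_neg h2] at h3
    rcases h3 with h3 | h3 <;> linarith
  have hB : ∀ q ∈ S, Y q = 0 → X q ≤ -e := by
    intro q hq h
    have h1 := hsX q hq ((hY0 q).1 h)
    have h2 : X q < 0 := by simpa [hX] using h1
    have h3 := hbox' q hq
    rw [h, abs_zero, abs_of_neg h2] at h3
    rcases h3 with h3 | h3 <;> linarith
  have K1 := lemK S hpc X Y hXc hYc e hA (by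
    intro q₁ h₁ q₂ h₂ h hl hr
    obtain ⟨q, hq, hqi, hqj⟩ := oc_slice_sgn S hoc 0 1 (by decide) s hs p q₁ q₂ h₁ h₂
      ((hYY _ _).1 h) (by simpa [hX] using hl) (by simpa only [hX] using hr)
    exact ⟨q, hq, (hX0 q).2 hqi, ((hYY _ _).2 hqj).trans h⟩)
  have K2 := lemK S hpc Y X hYc hXc e hB (by
    intro q₁ h₁ q₂ h₂ h hl hr'
    obtain ⟨q, hq, hqi, hqj⟩ := oc_slice_sgn S hoc 1 0 (by decide) r hr p q₁ q₂ h₁ h₂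
      ((hXX _ _).1 h) (by simpa [hY] using hl) (by simpa only [hY] using hr')
    exact ⟨q, hq, (hY0 q).2 hqi, ((hXX _ _).2 hqj).trans h⟩)
  have hXp : X p = 0 := (hX0 p).2 rfl
  have hYp : Y p = 0 := (hY0 p).2 rfl
  have hs' : ∀ q : E2, s * q 0 = s * p 0 + X q := fun q => by rw [hX]; ring
  have hr' : ∀ q : E2, r * q 1 = r * p 1 + Y q := fun q => by rw [hY]; ring
  have hns : -s * -s = 1 := by linarith
  have hnr : -r * -r = 1 := by linarith
  -- separating families
  have F1 : (∀ q ∈ S, X q ≤ -e ∨ Y q ≤ -e) → ∃ H, IsStaircaseHalfplane H ∧ S ⊆ H ∧ p ∉ H := by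
    intro h
    refine ⟨_, (stHalf s r hs hr (s * p 0 - e) (r * p 1 - e) (s * p 0 - e / 2) (r * p 1 - e / 2)
      (by linarith) (by linarith)).1, fun q hq => ?_, ?_⟩
    · have := h q hq
      have h1 := hs' q
      have h2 := hr' q
      simp only [Set.mem_ofPred_eq, stF, stG_le_iff, stG_ge_iff]
      rcases this with h | h
      · left; left; linarith
      · left; right; linarith
    · simp only [Set.mem_ofPred_eq, stF, stG_le_iff, stG_ge_iff]
      rintro H
      rcases H with (H | H) | ⟨H, H'⟩ <;> linarith
  have F4 : (∀ q ∈ S, 0 < X q ∧ 0 < Y q) → ∃ H, IsStaircaseHalfplane H ∧ S ⊆ H ∧ p ∉ H := by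
    intro h
    refine ⟨_, (stHalf s r hs hr (s * p 0) (r * p 1) (s * p 0 + e) (r * p 1 + e)
      (by linarith) (by linarith)).2, fun q hq => ?_, ?_⟩
    · have := h q hq
      have h0 := hbox' q hq
      rw [abs_of_pos this.1, abs_of_pos this.2] at h0
      have h1 := hs' q
      have h2 := hr' q
      simp only [Set.mem_ofPred_eq, stF, stG_le_iff, stG_ge_iff]
      refine ⟨⟨by linarith [this.1], by linarith [this.2]⟩, h0.imp (fun h => ?_) (fun h => ?_)⟩ <;> linarith
    · simp only [Set.mem_ofPred_eq, stF, stG_le_iff, stG_ge_iff]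
      rintro H
      rcases H with ⟨_, H | H⟩ <;> linarith
  rcases K1 with K1 | K1 <;> rcases K2 with K2 | K2
  · apply F1
    intro q hq
    have h1 := K1 q hq
    have h2 := K2 q hq
    exact c1 he (hbox' q hq) h1 h2
  · refine ⟨_, (stHalf s (-r) hs hnr (s * p 0 - e) (-r * p 1 - 2 * e) (s * p 0) (-r * p 1 - e)
      (by linarith) (by linarith)).1, fun q hq => ?_, ?_⟩
    · have h1 := K1 q hq
      have h2 := K2 q hq
      have h4 := hs' q
      have h5 : -r * q 1 = -r * p 1 - Y q := by linarith [hr' q]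
      simp only [Set.mem_ofPred_eq, stF, stG_le_iff, stG_ge_iff, h4, h5]
      rcases c2 he (hbox' q hq) h1 h2 with (h | h) | ⟨h, h'⟩
      · left; left; linarith
      · left; right; linarith
      · right; constructor <;> linarith
    · simp only [Set.mem_ofPred_eq, stF, stG_le_iff, stG_ge_iff]
      rintro H
      rcases H with (H | H) | ⟨H, H'⟩ <;> linarith
  · refine ⟨_, (stHalf (-s) r hns hr (-s * p 0 - 2 * e) (r * p 1 - e) (-s * p 0 - e) (r * p 1)
      (by linarith) (by linarith)).1, fun q hq => ?_, ?_⟩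
    · have h1 := K1 q hq
      have h2 := K2 q hq
      have h4 := hr' q
      have h5 : -s * q 0 = -s * p 0 - X q := by linarith [hs' q]
      simp only [Set.mem_ofPred_eq, stF, stG_le_iff, stG_ge_iff, h4, h5]
      rcases c3 he (hbox' q hq) h1 h2 with (h | h) | ⟨h, h'⟩
      · left; left; linarith
      · left; right; linarith
      · right; constructor <;> linarith
    · simp only [Set.mem_ofPred_eq, stF, stG_le_iff, stG_ge_iff]
      rintro H
      rcases H with (H | H) | ⟨H, H'⟩ <;> linarith
  · have hd : ∀ q ∈ S, (X q < 0 ∧ Y q ≤ -e) ∨ (0 < X q ∧ 0 < Y q) := by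
      intro q hq
      have h1 := K1 q hq
      have h2 := K2 q hq
      exact c4 he (hbox' q hq) h1 h2
    by_cases hex : ∃ q ∈ S, 0 < X q
    · obtain ⟨b, hb, hbX⟩ := hex
      apply F4
      intro q hq
      by_contra hcon
      have hqX : X q < 0 := by
        rcases hd q hq with h | h
        · exact h.1
        · exact absurd h hcon
      obtain ⟨z, _, hz1, hz2⟩ := hpc {q | X q < 0} {q | 0 < X q} (isOpen_lt hXc continuous_const)
        (isOpen_lt continuous_const hXc)
        (fun z hz => (hd z hz).imp (fun h => h.1) (fun h => h.1)) ⟨q, hq, hqX⟩ ⟨b, hb, hbX⟩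
      exact lt_asymm (show X z < 0 from hz1) (show 0 < X z from hz2)
    · push Not at hex
      apply F1
      intro q hq
      rcases hd q hq with h | h
      · exact Or.inr h.2
      · have := hex q hq
        linarith [h.1]

/-- Every path-connected, closed, and orthogonally convex set `S ⊆ ℝ²` is the
intersection of the family of all staircase-halfplanes containing it. -/
theorem closed_orthoConvex_eq_sInter_staircaseHalfplanes
    (S : Set (EuclideanSpace ℝ (Fin 2)))
    (hpc : IsPathConnected S) (hcl : IsClosed S) (hoc : OrthoConvex S) :
    S = ⋂₀ {H : Set (EuclideanSpace ℝ (Fin 2)) | IsStaircaseHalfplane H ∧ S ⊆ H} := by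
  apply Set.Subset.antisymm
  · exact Set.subset_sInter fun H hH => hH.2
  · intro p hp
    by_contra hpS
    obtain ⟨H, h1, h2, h3⟩ := oc_sep S hpc.isConnected.isPreconnected hcl hoc p hpS
    exact h3 (hp H ⟨h1, h2⟩)
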